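/- Let P be a finite (3+1)-free poset. Every order automorphism of P maps each part of P onto itself, and the resulting restriction map is a group isomorphism from Aut(P) onto the direct product, taken over all parts X of P, of the automorphism groups of the induced subposets on X. (In particular, Aut(P) ≅ ∏_{i=1}^r Aut(C_i) × ∏_{j=1}^s Aut(T_j), where C_1, …, C_r are the clone sets and T_1, …, T_s the tangles of P.) -/

import Mathlib

/-- Two elements of a poset are incomparable. -/
def Incomp {β : Type*} [PartialOrder β] (x y : β) : Prop := ¬ x ≤ y ∧ ¬ y ≤ x

/-- A poset is `(3+1)`-free if it contains no induced subposet consisting of a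
3-element chain together with an incomparable extra element. -/
def ThreePlusOneFree (α : Type*) [PartialOrder α] : Prop :=
  ¬ ∃ a b c d : α, a < b ∧ b < c ∧ Incomp d a ∧ Incomp d b ∧ Incomp d c

variable {α : Type*} [PartialOrder α]

/-- The strict downset `D_a` of a vertex. -/
def Dset (a : α) : Set α := {x | x < a}

/-- The strict upset `U_a` of a vertex. -/
def Uset (a : α) : Set α := {x | a < x}

/-- `a ⊤⊤ b` : the strict downsets of `a` and `b` are incomparable under inclusion. -/
def TTrel (a b : α) : Prop := ¬ Dset a ⊆ Dset b ∧ ¬ Dset b ⊆ Dset a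

/-- `a ⊥⊥ b` : the strict upsets of `a` and `b` are incomparable under inclusion. -/
def BBrel (a b : α) : Prop := ¬ Uset a ⊆ Uset b ∧ ¬ Uset b ⊆ Uset a

/-- The view `v(a) = (D_a, P \ U_a)` of a vertex, an element of `Set α × Set α`
with the componentwise inclusion order; note `v(a) ≤ v(b) ↔ D_a ⊆ D_b ∧ U_b ⊆ U_a`. -/
def view (a : α) : Set α × Set α := (Dset a, (Uset a)ᶜ)

/-- A top of a tangle: a connected component, with at least two vertices, of the graph
on the vertices of `P` with edge relation `⊤⊤`. -/
def IsTopOfTangle (A : Set α) : Prop :=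
  2 ≤ A.ncard ∧ ∃ a, A = {b | Relation.ReflTransGen TTrel a b}

/-- A bottom of a tangle: a connected component, with at least two vertices, of the graph
on the vertices of `P` with edge relation `⊥⊥`. -/
def IsBottomOfTangle (B : Set α) : Prop :=
  2 ≤ B.ncard ∧ ∃ b, B = {a | Relation.ReflTransGen BBrel b a}

/-- A top of a tangle `A` and a bottom of a tangle `B` are matched when they contain the
top and bottom pairs of an induced `(2+2)` subposet. -/
def Matched (A B : Set α) : Prop :=
  ∃ a ∈ A, ∃ a' ∈ A, ∃ b ∈ B, ∃ b' ∈ B,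
    b < a ∧ b' < a' ∧ Incomp a a' ∧ Incomp b b' ∧ Incomp a b' ∧ Incomp a' b

/-- A tangle, regarded as a vertex set: the union of a matched top and bottom. -/
def IsTangle (X : Set α) : Prop :=
  ∃ A B : Set α, IsTopOfTangle A ∧ IsBottomOfTangle B ∧ Matched A B ∧ X = A ∪ B

/-- A vertex lying in no top of a tangle and no bottom of a tangle. -/
def NotInTanglePart (a : α) : Prop :=
  (∀ A : Set α, IsTopOfTangle A → a ∉ A) ∧ (∀ B : Set α, IsBottomOfTangle B → a ∉ B)

/-- A clone set: an equivalence class under "same view" of the vertices lying in no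
top or bottom of a tangle. -/
def IsCloneSet (C : Set α) : Prop :=
  ∃ a : α, NotInTanglePart a ∧ C = {b | NotInTanglePart b ∧ view b = view a}

/-- The parts of a `(3+1)`-free poset: its clone sets and its tangles. -/
def IsPart (X : Set α) : Prop := IsCloneSet X ∨ IsTangle X

/-- The level `ℓ(a)` of a vertex: the maximum number of elements in a chain of `P`
whose greatest element is `a`. -/
noncomputable def level (a : α) : ℕ :=
  sSup {n | ∃ s : Finset α, s.card = n ∧ IsChain (· ≤ ·) (↑s : Set α) ∧ a ∈ s ∧ ∀ x ∈ s, x ≤ a}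

/-- A compatible listing of the parts of a `(3+1)`-free poset: an enumeration
`X_1, …, X_k` (each part listed exactly once) such that for vertices in distinct parts,
`a < b` holds exactly when `ℓ(a) ≤ ℓ(b) - 2`, or `ℓ(a) = ℓ(b) - 1` and `i < j`. -/
noncomputable def CompatibleListing {k : ℕ} (X : Fin k → Set α) : Prop :=
  Function.Injective X ∧ (∀ Y : Set α, IsPart Y ↔ ∃ i, X i = Y) ∧
    ∀ i j : Fin k, i ≠ j → ∀ a ∈ X i, ∀ b ∈ X j,
      (a < b ↔ (level a + 2 ≤ level b ∨ (level a + 1 = level b ∧ i < j)))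

lemma ttrel_iff {a b : α} :
    TTrel a b ↔ (∃ x, x < a ∧ ¬ x < b) ∧ ∃ y, y < b ∧ ¬ y < a := by
  simp [TTrel, Dset]

lemma bbrel_iff {a b : α} :
    BBrel a b ↔ (∃ x, a < x ∧ ¬ b < x) ∧ ∃ y, b < y ∧ ¬ a < y := by
  simp [BBrel, Uset]

lemma TTrel.symm {a b : α} (h : TTrel a b) : TTrel b a := ⟨h.2, h.1⟩

lemma BBrel.symm {a b : α} (h : BBrel a b) : BBrel b a := ⟨h.2, h.1⟩

lemma TTrel.reach_symm {a b : α} (h : Relation.ReflTransGen TTrel a b) :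
    Relation.ReflTransGen TTrel b a :=
  haveI : Std.Symm (TTrel (α := α)) := ⟨fun _ _ => TTrel.symm⟩
  Std.Symm.symm _ _ h

lemma BBrel.reach_symm {a b : α} (h : Relation.ReflTransGen BBrel a b) :
    Relation.ReflTransGen BBrel b a :=
  TTrel.reach_symm (α := αᵒᵈ) h

/-- `a` and `b` are the tops, and `x` and `y` the respective bottoms, of a `(2+2)` subposet. -/
structure TwoPlusTwo (a b x y : α) : Prop where
  left : x < a
  right : y < b
  cross : ¬ x < b
  cross' : ¬ y < a

namespace TwoPlusTwo

variable {a b c x y z a' b' x' y' : α}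

lemma swap (q : TwoPlusTwo a b x y) : TwoPlusTwo b a y x :=
  ⟨q.right, q.left, q.cross', q.cross⟩

lemma dual (q : TwoPlusTwo a b x y) :
    TwoPlusTwo (α := αᵒᵈ) (OrderDual.toDual x) (OrderDual.toDual y)
      (OrderDual.toDual a) (OrderDual.toDual b) :=
  ⟨q.left, q.right, q.cross', q.cross⟩

lemma ttrel (q : TwoPlusTwo a b x y) : TTrel a b :=
  ttrel_iff.2 ⟨⟨x, q.left, q.cross⟩, y, q.right, q.cross'⟩

lemma bbrel (q : TwoPlusTwo a b x y) : BBrel x y :=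
  bbrel_iff.2 ⟨⟨a, q.left, q.cross'⟩, b, q.right, q.cross⟩

lemma incomp_top (q : TwoPlusTwo a b x y) : Incomp a b :=
  ⟨fun h => q.cross (q.left.trans_le h), fun h => q.cross' (q.right.trans_le h)⟩

lemma incomp_bot (q : TwoPlusTwo a b x y) : Incomp x y :=
  ⟨fun h => q.cross (h.trans_lt q.right), fun h => q.cross' (h.trans_lt q.left)⟩

lemma incomp_cross (q : TwoPlusTwo a b x y) : Incomp a y :=
  ⟨fun h => q.cross (q.left.trans (h.trans_lt q.right)), fun h => by
    rcases h.eq_or_lt with rfl | h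
    · exact q.cross (q.left.trans q.right)
    · exact q.cross' h⟩

lemma of_ttrel (h : TTrel a b) (hx : x < a) (hx' : ¬ x < b) : ∃ y, TwoPlusTwo a b x y := by
  obtain ⟨-, y, hy, hy'⟩ := ttrel_iff.1 h
  exact ⟨y, hx, hy, hx', hy'⟩

lemma exists_of_ttrel (h : TTrel a b) : ∃ x y, TwoPlusTwo a b x y := by
  obtain ⟨⟨x, hx, hx'⟩, -⟩ := ttrel_iff.1 h
  exact ⟨x, of_ttrel h hx hx'⟩

lemma exists_of_bbrel (h : BBrel x y) : ∃ a b, TwoPlusTwo a b x y := by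
  obtain ⟨a, b, q⟩ := exists_of_ttrel (α := αᵒᵈ) h
  exact ⟨a, b, q.dual⟩

lemma reach_bot_step (q : TwoPlusTwo a b x y) (q' : TwoPlusTwo b c x' y') :
    Relation.ReflTransGen BBrel x x' := by
  by_cases h : x' < a
  · refine .head q.bbrel ?_
    by_cases h' : y < c
    · exact .single (TwoPlusTwo.bbrel (a := c) (b := a) ⟨h', h, q.cross', q'.cross⟩)
    · exact .head (TwoPlusTwo.bbrel (a := b) (b := c) ⟨q.right, q'.right, h', q'.cross'⟩)
        (.single q'.bbrel.symm)
  · exact .single (TwoPlusTwo.bbrel ⟨q.left, q'.left, q.cross, h⟩)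

lemma reach_bot (q : TwoPlusTwo a b x y) (h : Relation.ReflTransGen TTrel a a')
    (q' : TwoPlusTwo a' b' x' y') : Relation.ReflTransGen BBrel x x' := by
  induction h generalizing b' x' y' with
  | refl => exact .head q.bbrel (q.swap.reach_bot_step q')
  | tail _ h ih =>
    obtain ⟨u, v, r⟩ := exists_of_ttrel h
    exact (ih r).trans (r.reach_bot_step q')

lemma reach_top (q : TwoPlusTwo a b x y) (h : Relation.ReflTransGen BBrel x x')
    (q' : TwoPlusTwo a' b' x' y') : Relation.ReflTransGen TTrel a a' :=
  q.dual.reach_bot (α := αᵒᵈ) h q'.dual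

/-- The tangle generated by a `(2+2)` with top `a` and bottom `x` in the same chain. -/
def tangle (a x : α) : Set α :=
  {b | Relation.ReflTransGen TTrel a b} ∪ {y | Relation.ReflTransGen BBrel x y}

lemma exists_of_reach_top (q : TwoPlusTwo a b x y) (h : Relation.ReflTransGen TTrel a c) :
    ∃ d u v, TwoPlusTwo c d u v := by
  rcases h.cases_tail with rfl | ⟨d, -, hd⟩
  · exact ⟨b, x, y, q⟩
  · exact ⟨d, exists_of_ttrel hd.symm⟩

lemma exists_of_reach_bot (q : TwoPlusTwo a b x y) (h : Relation.ReflTransGen BBrel x z) :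
    ∃ u v w, TwoPlusTwo u v z w := by
  obtain ⟨w, u, v, r⟩ := q.dual.exists_of_reach_top (α := αᵒᵈ) h
  exact ⟨u, v, w, r.dual⟩

lemma lt_iff_of_reach_top (q : TwoPlusTwo a b x y) (h : Relation.ReflTransGen TTrel a c)
    {u : α} (hu : ¬ Relation.ReflTransGen BBrel x u) : u < a ↔ u < c := by
  induction h with
  | refl => rfl
  | @tail c d hc hcd ih =>
    rw [ih]
    by_contra! H
    rcases H with ⟨h₁, h₂⟩ | ⟨h₁, h₂⟩
    · obtain ⟨v, r⟩ := of_ttrel hcd h₁ h₂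
      exact hu (q.reach_bot hc r)
    · obtain ⟨v, r⟩ := of_ttrel hcd.symm h₂ h₁
      exact hu (q.reach_bot (hc.tail hcd) r)

lemma lt_iff_of_reach_bot (q : TwoPlusTwo a b x y) (h : Relation.ReflTransGen BBrel x z)
    {u : α} (hu : ¬ Relation.ReflTransGen TTrel a u) : x < u ↔ z < u :=
  q.dual.lt_iff_of_reach_top (α := αᵒᵈ) h hu

end TwoPlusTwo

lemma Incomp.symm {a b : α} (h : Incomp a b) : Incomp b a := ⟨h.2, h.1⟩

lemma ThreePlusOneFree.dual (h : ThreePlusOneFree α) : ThreePlusOneFree αᵒᵈ := by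
  rintro ⟨a, b, c, d, hab, hbc, ha, hb, hc⟩
  exact h ⟨c, b, a, d, hbc, hab, hc.symm, hb.symm, ha.symm⟩

lemma ThreePlusOneFree.lt_of_ttrel (h : ThreePlusOneFree α) {a b u : α} (hab : TTrel a b)
    (hu : a < u) : b < u := by
  obtain ⟨x, y, q⟩ := TwoPlusTwo.exists_of_ttrel hab
  by_contra hbu
  refine h ⟨x, a, u, b, q.left, hu, q.swap.incomp_cross, q.incomp_top.symm, fun hle => ?_,
    fun hle => q.incomp_top.1 (hu.le.trans hle)⟩
  rcases hle.eq_or_lt with rfl | hlt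
  · exact q.incomp_top.1 hu.le
  · exact hbu hlt

lemma ThreePlusOneFree.lt_iff_of_reach_top (h : ThreePlusOneFree α) {a b u : α}
    (hab : Relation.ReflTransGen TTrel a b) : a < u ↔ b < u := by
  induction hab with
  | refl => rfl
  | tail _ hcd ih => exact ih.trans ⟨h.lt_of_ttrel hcd, h.lt_of_ttrel hcd.symm⟩

lemma ThreePlusOneFree.lt_iff_of_reach_bot (h : ThreePlusOneFree α) {x y u : α}
    (hxy : Relation.ReflTransGen BBrel x y) : u < x ↔ u < y :=
  h.dual.lt_iff_of_reach_top (α := αᵒᵈ) hxy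

lemma ThreePlusOneFree.not_bbrel_of_ttrel (h : ThreePlusOneFree α) {a b c : α}
    (hab : TTrel a b) : ¬ BBrel a c := by
  intro hac
  have hU : Uset a = Uset b := Set.ext fun _ => h.lt_iff_of_reach_top (.single hab)
  have hbc : BBrel b c := by rwa [BBrel, ← hU]
  have hD : Dset a = Dset b := Set.ext fun _ =>
    (h.lt_iff_of_reach_bot (.single hac)).trans (h.lt_iff_of_reach_bot (.single hbc)).symm
  exact hab.1 hD.subset

lemma IsTopOfTangle.exists_ttrel {A : Set α} (hA : IsTopOfTangle A) {a : α} (ha : a ∈ A) :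
    ∃ b, TTrel a b := by
  obtain ⟨hc, r, rfl⟩ := hA
  obtain ⟨c, hc, hne⟩ := Set.exists_ne_of_one_lt_ncard hc a
  rcases ((TTrel.reach_symm ha).trans hc).cases_head with rfl | ⟨b, hb, -⟩
  · exact absurd rfl hne
  · exact ⟨b, hb⟩

lemma IsBottomOfTangle.exists_bbrel {B : Set α} (hB : IsBottomOfTangle B) {a : α} (ha : a ∈ B) :
    ∃ b, BBrel a b :=
  IsTopOfTangle.exists_ttrel (α := αᵒᵈ) hB ha

lemma setOf_reach_top_eq {a b : α} (h : Relation.ReflTransGen TTrel a b) :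
    {c | Relation.ReflTransGen TTrel a c} = {c | Relation.ReflTransGen TTrel b c} :=
  Set.ext fun _ => ⟨(TTrel.reach_symm h).trans, h.trans⟩

lemma setOf_reach_bot_eq {a b : α} (h : Relation.ReflTransGen BBrel a b) :
    {c | Relation.ReflTransGen BBrel a c} = {c | Relation.ReflTransGen BBrel b c} :=
  setOf_reach_top_eq (α := αᵒᵈ) h

lemma IsTangle.exists_twoPlusTwo {X : Set α} (hX : IsTangle X) :
    ∃ a b x y, TwoPlusTwo a b x y ∧ X = TwoPlusTwo.tangle a x := by
  obtain ⟨_, _, ⟨-, r, rfl⟩, ⟨-, s, rfl⟩, ⟨a, ha, b, -, x, hx, y, -, hxa, hyb, -, -, hay, hbx⟩,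
    rfl⟩ := hX
  refine ⟨a, b, x, y, ⟨hxa, hyb, fun h => hbx.2 h.le, fun h => hay.2 h.le⟩, ?_⟩
  rw [TwoPlusTwo.tangle, setOf_reach_top_eq ha, setOf_reach_bot_eq hx]

lemma view_eq_iff {a b : α} : view a = view b ↔ Dset a = Dset b ∧ Uset a = Uset b := by
  simp [view]

namespace TwoPlusTwo

variable {a b x y : α}

lemma not_reach_bot_of_reach_top (q : TwoPlusTwo a b x y) {a' b' x' y' : α}
    (q' : TwoPlusTwo a' b' x' y') (h : ThreePlusOneFree α) {c : α}
    (hc : Relation.ReflTransGen TTrel a c) : ¬ Relation.ReflTransGen BBrel x' c := by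
  intro hc'
  obtain ⟨d, u, v, r⟩ := q.exists_of_reach_top hc
  obtain ⟨u', v', w, r'⟩ := q'.exists_of_reach_bot hc'
  exact h.not_bbrel_of_ttrel r.ttrel r'.bbrel

lemma tangle_eq_of_mem (q : TwoPlusTwo a b x y) {a' b' x' y' : α}
    (q' : TwoPlusTwo a' b' x' y') (h : ThreePlusOneFree α) {c : α}
    (hc : c ∈ tangle a x) (hc' : c ∈ tangle a' x') : tangle a x = tangle a' x' := by
  have key : Relation.ReflTransGen TTrel a a' ∧ Relation.ReflTransGen BBrel x x' := by
    rcases hc with hc | hc <;> rcases hc' with hc' | hc'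
    · have haa := Relation.ReflTransGen.trans hc (TTrel.reach_symm hc')
      exact ⟨haa, q.reach_bot haa q'⟩
    · exact absurd hc' (q.not_reach_bot_of_reach_top q' h hc)
    · exact absurd hc (q'.not_reach_bot_of_reach_top q h hc')
    · have hxx := Relation.ReflTransGen.trans hc (BBrel.reach_symm hc')
      exact ⟨q.reach_top hxx q', hxx⟩
  rw [tangle, tangle, setOf_reach_top_eq key.1, setOf_reach_bot_eq key.2]

lemma reach_top_iff_exists_lt (q : TwoPlusTwo a b x y) (h : ThreePlusOneFree α) {c : α}
    (hc : c ∈ tangle a x) :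
    Relation.ReflTransGen TTrel a c ↔ ∃ d ∈ tangle a x, d < c := by
  constructor
  · intro hac
    obtain ⟨d, u, v, r⟩ := q.exists_of_reach_top hac
    exact ⟨u, .inr (q.reach_bot hac r), r.left⟩
  · rintro ⟨d, hd, hdc⟩
    refine hc.resolve_right fun hxc => ?_
    have hdx : d < x := (h.lt_iff_of_reach_bot hxc).2 hdc
    rcases hd with hd | hd
    · exact lt_asymm q.left ((h.lt_iff_of_reach_top hd).2 hdx)
    · exact lt_irrefl d ((h.lt_iff_of_reach_bot hd).1 hdx)

lemma lt_iff_of_orderIso (q : TwoPlusTwo a b x y) (h : ThreePlusOneFree α)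
    (ψ : tangle a x ≃o tangle a x) (c : tangle a x) {u : α} (hu : u ∉ tangle a x) :
    (u < ψ c ↔ u < c) ∧ ((ψ c : α) < u ↔ (c : α) < u) := by
  have hiff : Relation.ReflTransGen TTrel a (ψ c) ↔ Relation.ReflTransGen TTrel a c := by
    rw [q.reach_top_iff_exists_lt h (ψ c).2, q.reach_top_iff_exists_lt h c.2]
    constructor
    · rintro ⟨d, hd, hdc⟩
      exact ⟨ψ.symm ⟨d, hd⟩, Subtype.coe_prop _, ψ.symm_apply_lt.2 hdc⟩
    · rintro ⟨d, hd, hdc⟩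
      exact ⟨ψ ⟨d, hd⟩, Subtype.coe_prop _, ψ.lt_iff_lt.2 (show (⟨d, hd⟩ : tangle a x) < c from hdc)⟩
  have hu₁ : ¬ Relation.ReflTransGen TTrel a u := fun H => hu (.inl H)
  have hu₂ : ¬ Relation.ReflTransGen BBrel x u := fun H => hu (.inr H)
  by_cases hc : Relation.ReflTransGen TTrel a c
  · have hc' := hiff.2 hc
    exact ⟨(q.lt_iff_of_reach_top hc' hu₂).symm.trans (q.lt_iff_of_reach_top hc hu₂),
      (h.lt_iff_of_reach_top hc').symm.trans (h.lt_iff_of_reach_top hc)⟩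
  · have hxc' := (ψ c).2.resolve_left (mt hiff.1 hc)
    have hxc := c.2.resolve_left hc
    exact ⟨(h.lt_iff_of_reach_bot hxc').symm.trans (h.lt_iff_of_reach_bot hxc),
      (q.lt_iff_of_reach_bot hxc' hu₁).symm.trans (q.lt_iff_of_reach_bot hxc hu₁)⟩

end TwoPlusTwo

namespace OrderIso

variable (φ : α ≃o α)

lemma image_Dset (a : α) : φ '' Dset a = Dset (φ a) := φ.image_Iio a

lemma image_Uset (a : α) : φ '' Uset a = Uset (φ a) := φ.image_Ioi a

lemma ttrel_iff {a b : α} : TTrel (φ a) (φ b) ↔ TTrel a b := by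
  simp only [TTrel, ← image_Dset, Set.image_subset_image_iff φ.injective]

lemma bbrel_iff {a b : α} : BBrel (φ a) (φ b) ↔ BBrel a b := by
  simp only [BBrel, ← image_Uset, Set.image_subset_image_iff φ.injective]

end OrderIso

/-- An automorphism of a part does not change how its vertices compare with outside vertices. -/
lemma IsPart.lt_iff_of_orderIso (h : ThreePlusOneFree α) {X : Set α} (hX : IsPart X) (ψ : X ≃o X)
    (c : X) {u : α} (hu : u ∉ X) : (u < ψ c ↔ u < c) ∧ ((ψ c : α) < u ↔ (c : α) < u) := by
  rcases hX with ⟨r, hr, rfl⟩ | hX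
  · obtain ⟨hD, hU⟩ := view_eq_iff.1 ((ψ c).2.2.trans c.2.2.symm)
    exact ⟨Set.ext_iff.1 hD u, Set.ext_iff.1 hU u⟩
  · obtain ⟨_, _, _, _, q, rfl⟩ := hX.exists_twoPlusTwo
    exact q.lt_iff_of_orderIso h ψ c hu

section Finite

variable [Finite α]

lemma TTrel.isTopOfTangle {a b : α} (h : TTrel a b) :
    IsTopOfTangle {c | Relation.ReflTransGen TTrel a c} := by
  refine ⟨?_, a, rfl⟩
  rw [Nat.succ_le_iff, Set.one_lt_ncard_iff]
  refine ⟨a, b, .refl, .single h, ?_⟩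
  rintro rfl
  exact h.1 subset_rfl

lemma BBrel.isBottomOfTangle {a b : α} (h : BBrel a b) :
    IsBottomOfTangle {c | Relation.ReflTransGen BBrel a c} :=
  TTrel.isTopOfTangle (α := αᵒᵈ) h

lemma notInTanglePart_iff {a : α} :
    NotInTanglePart a ↔ (∀ b, ¬ TTrel a b) ∧ ∀ b, ¬ BBrel a b := by
  constructor
  · exact fun h => ⟨fun b hb => h.1 _ hb.isTopOfTangle .refl,
      fun b hb => h.2 _ hb.isBottomOfTangle .refl⟩
  · refine fun h => ⟨fun A hA ha => ?_, fun B hB ha => ?_⟩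
    · obtain ⟨b, hb⟩ := hA.exists_ttrel ha
      exact h.1 b hb
    · obtain ⟨b, hb⟩ := hB.exists_bbrel ha
      exact h.2 b hb

namespace TwoPlusTwo

variable {a b x y : α}

lemma isTangle (q : TwoPlusTwo a b x y) : IsTangle (tangle a x) :=
  ⟨_, _, q.ttrel.isTopOfTangle, q.bbrel.isBottomOfTangle,
    ⟨a, .refl, b, .single q.ttrel, x, .refl, y, .single q.bbrel, q.left, q.right,
      q.incomp_top, q.incomp_bot, q.incomp_cross, q.swap.incomp_cross⟩, rfl⟩

lemma not_notInTanglePart (q : TwoPlusTwo a b x y) {c : α} (hc : c ∈ tangle a x) :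
    ¬ NotInTanglePart c := by
  rw [notInTanglePart_iff]
  rintro ⟨h₁, h₂⟩
  rcases hc with hc | hc
  · obtain ⟨d, u, v, r⟩ := q.exists_of_reach_top hc
    exact h₁ d r.ttrel
  · obtain ⟨u, v, w, r⟩ := q.exists_of_reach_bot hc
    exact h₂ w r.bbrel

end TwoPlusTwo

lemma exists_isPart_mem (a : α) : ∃ X, IsPart X ∧ a ∈ X := by
  by_cases ha : NotInTanglePart a
  · exact ⟨_, .inl ⟨a, ha, rfl⟩, ha, rfl⟩
  · rw [notInTanglePart_iff, not_and_or] at ha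
    push Not at ha
    rcases ha with ⟨b, hb⟩ | ⟨b, hb⟩
    · obtain ⟨x, y, q⟩ := TwoPlusTwo.exists_of_ttrel hb
      exact ⟨_, .inr q.isTangle, .inl .refl⟩
    · obtain ⟨u, v, q⟩ := TwoPlusTwo.exists_of_bbrel hb
      exact ⟨_, .inr q.isTangle, .inr .refl⟩

lemma IsPart.eq_of_mem (h : ThreePlusOneFree α) {X Y : Set α} (hX : IsPart X) (hY : IsPart Y) {a : α}
    (haX : a ∈ X) (haY : a ∈ Y) : X = Y := by
  rcases hX with ⟨r, hr, rfl⟩ | hX <;> rcases hY with ⟨s, hs, rfl⟩ | hY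
  · rw [← haX.2, ← haY.2]
  · obtain ⟨_, _, _, _, q, rfl⟩ := hY.exists_twoPlusTwo
    exact absurd haX.1 (q.not_notInTanglePart haY)
  · obtain ⟨_, _, _, _, q, rfl⟩ := hX.exists_twoPlusTwo
    exact absurd haY.1 (q.not_notInTanglePart haX)
  · obtain ⟨_, _, _, _, q, rfl⟩ := hX.exists_twoPlusTwo
    obtain ⟨_, _, _, _, q', rfl⟩ := hY.exists_twoPlusTwo
    exact q.tangle_eq_of_mem q' h haX haY

namespace OrderIso

variable (φ : α ≃o α)

lemma notInTanglePart_iff {a : α} : NotInTanglePart (φ a) ↔ NotInTanglePart a := by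
  rw [_root_.notInTanglePart_iff, _root_.notInTanglePart_iff]
  exact and_congr (φ.surjective.forall.trans (forall_congr' fun _ => not_congr φ.ttrel_iff))
    (φ.surjective.forall.trans (forall_congr' fun _ => not_congr φ.bbrel_iff))

lemma ttrel_or_Dset_eq (a : α) : TTrel a (φ a) ∨ Dset a = Dset (φ a) := by
  have hcard : (Dset (φ a)).ncard = (Dset a).ncard := by
    rw [← image_Dset, Set.ncard_image_of_injective _ φ.injective]
  by_cases h₁ : Dset a ⊆ Dset (φ a)
  · exact .inr (Set.eq_of_subset_of_ncard_le h₁ hcard.le)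
  by_cases h₂ : Dset (φ a) ⊆ Dset a
  · exact .inr (Set.eq_of_subset_of_ncard_le h₂ hcard.ge).symm
  · exact .inl ⟨h₁, h₂⟩

lemma bbrel_or_Uset_eq (a : α) : BBrel a (φ a) ∨ Uset a = Uset (φ a) :=
  ttrel_or_Dset_eq (α := αᵒᵈ) φ.dual a

lemma reach_top_apply {a b : α} (h : TTrel a b) : Relation.ReflTransGen TTrel a (φ a) := by
  rcases φ.ttrel_or_Dset_eq a with h' | h'
  · exact .single h'
  · have hb : TTrel (φ a) b := by rwa [TTrel, ← h']
    exact .head h (.single hb.symm)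

lemma reach_bot_apply {a b : α} (h : BBrel a b) : Relation.ReflTransGen BBrel a (φ a) :=
  reach_top_apply (α := αᵒᵈ) φ.dual h

lemma apply_mem_of_isPart {X : Set α} (hX : IsPart X) {a : α} (ha : a ∈ X) : φ a ∈ X := by
  rcases hX with ⟨r, hr, rfl⟩ | hX
  · refine ⟨φ.notInTanglePart_iff.2 ha.1, Eq.trans (Eq.symm ?_) ha.2⟩
    have hn := _root_.notInTanglePart_iff.1 ha.1
    exact view_eq_iff.2 ⟨(φ.ttrel_or_Dset_eq a).resolve_left (hn.1 _),
      (φ.bbrel_or_Uset_eq a).resolve_left (hn.2 _)⟩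
  · obtain ⟨_, _, _, _, q, rfl⟩ := hX.exists_twoPlusTwo
    rcases ha with ha | ha
    · obtain ⟨_, _, _, r⟩ := q.exists_of_reach_top ha
      exact .inl (Relation.ReflTransGen.trans ha (φ.reach_top_apply r.ttrel))
    · obtain ⟨_, _, _, r⟩ := q.exists_of_reach_bot ha
      exact .inr (Relation.ReflTransGen.trans ha (φ.reach_bot_apply r.bbrel))

/-- The restriction of an automorphism to a part. -/
def restrictPart {X : Set α} (hX : IsPart X) : X ≃o X where
  toFun x := ⟨φ x, φ.apply_mem_of_isPart hX x.2⟩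
  invFun x := ⟨φ.symm x, φ.symm.apply_mem_of_isPart hX x.2⟩
  left_inv x := Subtype.ext (φ.symm_apply_apply x)
  right_inv x := Subtype.ext (φ.apply_symm_apply x)
  map_rel_iff' := φ.le_iff_le

/-- Restriction to the parts, as a group homomorphism. -/
def restrictParts : (α ≃o α) →* (∀ X : {X : Set α // IsPart X}, (X.1 ≃o X.1)) where
  toFun φ X := φ.restrictPart X.2
  map_one' := rfl
  map_mul' _ _ := rfl

end OrderIso

/-- The map obtained by gluing maps of the parts. -/
noncomputable def gluePart (ψ : ∀ X : {X : Set α // IsPart X}, (X.1 ≃o X.1)) (a : α) : α :=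
  ψ ⟨(exists_isPart_mem a).choose, (exists_isPart_mem a).choose_spec.1⟩
    ⟨a, (exists_isPart_mem a).choose_spec.2⟩

lemma gluePart_apply (h : ThreePlusOneFree α)
    (ψ : ∀ X : {X : Set α // IsPart X}, (X.1 ≃o X.1)) (X : {X : Set α // IsPart X}) (a : X.1) :
    gluePart ψ a = ψ X a := by
  have key : ∀ (Y : {X : Set α // IsPart X}) (haY : (a : α) ∈ Y.1),
      (ψ Y ⟨a, haY⟩ : α) = ψ X a := by
    intro Y haY
    obtain rfl : Y = X := Subtype.ext (Y.2.eq_of_mem h X.2 haY a.2)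
    rfl
  exact key _ _

lemma gluePart_inv_gluePart (h : ThreePlusOneFree α)
    (ψ : ∀ X : {X : Set α // IsPart X}, (X.1 ≃o X.1)) (a : α) :
    gluePart ψ⁻¹ (gluePart ψ a) = a := by
  obtain ⟨X, hX, ha⟩ := exists_isPart_mem a
  rw [gluePart_apply h ψ ⟨X, hX⟩ ⟨a, ha⟩, gluePart_apply h ψ⁻¹ ⟨X, hX⟩]
  exact congrArg Subtype.val ((ψ ⟨X, hX⟩).symm_apply_apply ⟨a, ha⟩)

lemma gluePart_lt_iff (h : ThreePlusOneFree α)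
    (ψ : ∀ X : {X : Set α // IsPart X}, (X.1 ≃o X.1)) (a b : α) :
    gluePart ψ a < gluePart ψ b ↔ a < b := by
  obtain ⟨X, hX, ha⟩ := exists_isPart_mem a
  obtain ⟨Y, hY, hb⟩ := exists_isPart_mem b
  rw [gluePart_apply h ψ ⟨X, hX⟩ ⟨a, ha⟩, gluePart_apply h ψ ⟨Y, hY⟩ ⟨b, hb⟩]
  by_cases hXY : X = Y
  · subst hXY
    exact (ψ ⟨X, hX⟩).lt_iff_lt
  · have hbX : b ∉ X := fun H => hXY (hX.eq_of_mem h hY H hb)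
    have hψaY : (ψ ⟨X, hX⟩ ⟨a, ha⟩ : α) ∉ Y :=
      fun H => hXY (hX.eq_of_mem h hY (Subtype.coe_prop _) H)
    exact (hY.lt_iff_of_orderIso h _ ⟨b, hb⟩ hψaY).1.trans
      (hX.lt_iff_of_orderIso h _ ⟨a, ha⟩ hbX).2

/-- The automorphism obtained by gluing automorphisms of the parts. -/
noncomputable def glueParts (h : ThreePlusOneFree α)
    (ψ : ∀ X : {X : Set α // IsPart X}, (X.1 ≃o X.1)) : α ≃o α where
  toFun := gluePart ψ
  invFun := gluePart ψ⁻¹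
  left_inv := gluePart_inv_gluePart h ψ
  right_inv := gluePart_inv_gluePart h ψ⁻¹
  map_rel_iff' := by
    intro a b
    have hinj : gluePart ψ a = gluePart ψ b ↔ a = b :=
      (Function.LeftInverse.injective (gluePart_inv_gluePart h ψ)).eq_iff
    change gluePart ψ a ≤ gluePart ψ b ↔ a ≤ b
    rw [le_iff_lt_or_eq, le_iff_lt_or_eq, gluePart_lt_iff h, hinj]

end Finite

/-- Let `P` be a finite `(3+1)`-free poset. Every order automorphism of
`P` maps each part of `P` onto itself, and the resulting restriction map is a group
isomorphism from `Aut(P)` onto the direct product, over all parts `X`, of the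
automorphism groups of the induced subposets on `X`. -/
theorem aut_eq_product_over_parts {α : Type*} [Fintype α] [PartialOrder α]
    (h : ThreePlusOneFree α) :
    (∀ (φ : α ≃o α) (X : Set α), IsPart X → φ '' X = X) ∧
    ∃ e : (α ≃o α) ≃* (∀ X : {X : Set α // IsPart X}, (↥X.1 ≃o ↥X.1)),
      ∀ (φ : α ≃o α) (X : {X : Set α // IsPart X}) (x : ↥X.1),
        ((e φ X) x : α) = φ (x : α) := by
  refine ⟨fun φ X hX => ?_, MulEquiv.ofBijective OrderIso.restrictParts ⟨fun φ φ' hφ => ?_,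
    fun ψ => ⟨glueParts h ψ, ?_⟩⟩, fun φ X x => rfl⟩
  · refine Set.Subset.antisymm ?_ fun a ha => ?_
    · rintro _ ⟨a, ha, rfl⟩
      exact φ.apply_mem_of_isPart hX ha
    · exact ⟨φ.symm a, φ.symm.apply_mem_of_isPart hX ha, φ.apply_symm_apply a⟩
  · ext a
    obtain ⟨X, hX, ha⟩ := exists_isPart_mem a
    exact congrArg Subtype.val (DFunLike.congr_fun (congrFun hφ ⟨X, hX⟩) ⟨a, ha⟩)
  · ext X x
    exact gluePart_apply h ψ X x
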